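/- Every (≤,∘)-structure S that has a (⊑,;)-representation satisfies σ: for all a,b ∈ S, if b ◄ a and a ◁^b b then a ≤ b. In particular, every representable structure satisfies σ_n for every n. -/

import Mathlib

/-- Simultaneous recursive definition of the predicates `◄ₙ` (first component)
and `◁ˢₙ` (second component, parametrised by `s`). -/
def BT {S : Type*} (le : S → S → Prop) (op : S → S → S) :
    ℕ → (S → S → Prop) × (S → S → S → Prop)
  | 0 =>
    (fun a b => le b a ∨ ∃ c, le (op b c) a,
     fun s a b => le a b ∧ s = b)
  | n + 1 =>
    (fun a b =>
        (BT le op n).2 a a b ∨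
        (∃ c, (BT le op n).1 a c ∧ (BT le op n).1 c b) ∨
        (∃ d f f', a = op d f ∧ (BT le op n).1 f f' ∧ b = op d f'),
     fun s a b =>
        (∃ c, (BT le op n).2 s a c ∧ (BT le op n).2 s c b) ∨
        (∃ c c' d d', a = op c d ∧ (BT le op n).2 s c c' ∧
          (BT le op n).2 d d d' ∧ b = op c' d') ∨
        (∃ s', (BT le op n).2 s' a b ∧ (BT le op n).1 s s'))

/-- `a ◄ₙ b` -/
def Bn {S : Type*} (le : S → S → Prop) (op : S → S → S) (n : ℕ) (a b : S) : Prop :=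
  (BT le op n).1 a b

/-- `a ◁ˢₙ b` -/
def Tn {S : Type*} (le : S → S → Prop) (op : S → S → S) (n : ℕ) (s a b : S) : Prop :=
  (BT le op n).2 s a b

/-- `a ◄ b` -/
def Binf {S : Type*} (le : S → S → Prop) (op : S → S → S) (a b : S) : Prop :=
  ∃ n, Bn le op n a b

/-- `a ◁ˢ b` -/
def Tinf {S : Type*} (le : S → S → Prop) (op : S → S → S) (s a b : S) : Prop :=
  ∃ n, Tn le op n s a b


/-- The domain of a binary relation. -/
def dom {X : Type*} (R : Set (X × X)) : Set X := {x | ∃ y, (x, y) ∈ R}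

/-- Composition of binary relations. -/
def rcomp {X : Type*} (R S : Set (X × X)) : Set (X × X) :=
  {p | ∃ z, (p.1, z) ∈ R ∧ (z, p.2) ∈ S}

/-- Demonic refinement `R ⊑ S`. -/
def refines {X : Type*} (R S : Set (X × X)) : Prop :=
  dom S ⊆ dom R ∧ ∀ p ∈ R, p.1 ∈ dom S → p ∈ S

/-- A `(⊑, ;)`-representation of a `(≤, ∘)`-structure. -/
def IsRepresentation {S X : Type*} (le : S → S → Prop) (op : S → S → S)
    (θ : S → Set (X × X)) : Prop :=
  (∀ a b, le a b ↔ refines (θ a) (θ b)) ∧ (∀ a b, θ (op a b) = rcomp (θ a) (θ b))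

/-- A structure is representable if it has a `(⊑, ;)`-representation over some base set. -/
def Representable (S : Type*) (le : S → S → Prop) (op : S → S → S) : Prop :=
  ∃ (X : Type) (θ : S → Set (X × X)), IsRepresentation le op θ

/-- Soundness of `◄ₙ` and `◁ˢₙ`: `a ◄ₙ b` forces an inclusion of domains, and `a ◁ˢₙ b` forces
the restriction of `θ a` to the domain of `θ s` to be contained in `θ b`. -/
theorem IsRepresentation.sound {S X : Type*} {le : S → S → Prop} {op : S → S → S}
    {θ : S → Set (X × X)} (h : IsRepresentation le op θ) (n : ℕ) :
    (∀ a b, Bn le op n a b → dom (θ a) ⊆ dom (θ b)) ∧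
    (∀ s a b, Tn le op n s a b → ∀ x y, (x, y) ∈ θ a → x ∈ dom (θ s) → (x, y) ∈ θ b) := by
  obtain ⟨hle, hop⟩ := h
  induction n with
  | zero =>
    refine ⟨?_, ?_⟩
    · rintro a b (hba | ⟨c, hc⟩)
      · exact ((hle _ _).1 hba).1
      · intro x hx
        obtain ⟨y, hy⟩ := ((hle _ _).1 hc).1 hx
        rw [hop] at hy
        obtain ⟨z, hz, -⟩ := hy
        exact ⟨z, hz⟩
    · rintro s a b ⟨hab, rfl⟩ x y hxy hx
      exact ((hle _ _).1 hab).2 _ hxy hx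
  | succ n ih =>
    obtain ⟨ihB, ihT⟩ := ih
    refine ⟨?_, ?_⟩
    · rintro a b (hab | ⟨c, hac, hcb⟩ | ⟨d, f, f', rfl, hf, rfl⟩)
      · rintro x ⟨y, hxy⟩
        exact ⟨y, ihT _ _ _ hab x y hxy ⟨y, hxy⟩⟩
      · exact (ihB _ _ hac).trans (ihB _ _ hcb)
      · rintro x ⟨y, hxy⟩
        rw [hop] at hxy
        obtain ⟨z, hxz, hzy⟩ := hxy
        obtain ⟨w, hzw⟩ := ihB _ _ hf ⟨y, hzy⟩
        refine ⟨w, ?_⟩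
        rw [hop]
        exact ⟨z, hxz, hzw⟩
    · rintro s a b (⟨c, hac, hcb⟩ | ⟨c, c', d, d', rfl, hc, hd, rfl⟩ | ⟨s', hab, hs⟩) x y hxy hx
      · exact ihT _ _ _ hcb x y (ihT _ _ _ hac x y hxy hx) hx
      · rw [hop] at hxy ⊢
        obtain ⟨z, hxz, hzy⟩ := hxy
        exact ⟨z, ihT _ _ _ hc x z hxz hx, ihT _ _ _ hd z y hzy ⟨y, hzy⟩⟩
      · exact ihT _ _ _ hab x y hxy (ihB _ _ hs hx)

/-- Lemma 3 (soundness of σ): every representable structure satisfies `σ`, and in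
particular every `σₙ`. -/
theorem stmt5 {S : Type*} (le : S → S → Prop) (op : S → S → S)
    (h : Representable S le op) :
    (∀ a b : S, Binf le op b a → Tinf le op b a b → le a b) ∧
    (∀ (n : ℕ) (a b : S), Bn le op n b a → Tn le op n b a b → le a b) := by
  obtain ⟨X, θ, h⟩ := h
  have key : ∀ a b : S, Binf le op b a → Tinf le op b a b → le a b := by
    rintro a b ⟨m, hba⟩ ⟨n, hab⟩
    exact (h.1 a b).2 ⟨(h.sound m).1 _ _ hba, fun p hp hx => (h.sound n).2 _ _ _ hab p.1 p.2 hp hx⟩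
  exact ⟨key, fun n a b hba hab => key a b ⟨n, hba⟩ ⟨n, hab⟩⟩
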